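/- arXiv:1010.5042 — 5 statements merged into one kernel-verified Lean document; each statement's English description precedes it below -/
import Mathlib

section
/- Fix r ∈ ℕ* and a real constant c > 0 such that η(C_m^r) ≤ c(m−1)+1 for every m ∈ ℕ*. Then for every finite abelian group G of rank r and exponent n, one has t(G) ≤ c · Σ_{d ∣ n} ( d / P^+(d)^{ν_{P^+(d)}(d)} − 1 ) + c(n−1) + 1. -/
open Multiset Finset

/-- The cross number of a sequence (multiset) over an additive group:
    the sum of the reciprocals of the orders of its elements. -/
noncomputable def crossNum {G : Type*} [AddCommGroup G] (S : Multiset G) : ℝ :=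
  (S.map fun g => (1 : ℝ) / (addOrderOf g : ℝ)).sum

/-- A tiny zero-sum sequence: non-empty, zero sum, cross number at most 1. -/
def IsTinyZS {G : Type*} [AddCommGroup G] (S' : Multiset G) : Prop :=
  S' ≠ 0 ∧ S'.sum = 0 ∧ crossNum S' ≤ 1

/-- `tC G` : the smallest `t ≥ 1` such that every sequence over `G` of length `≥ t`
    contains a tiny zero-sum subsequence. -/
noncomputable def tC (G : Type*) [AddCommGroup G] : ℕ :=
  sInf {t : ℕ | 0 < t ∧ ∀ S : Multiset G, t ≤ Multiset.card S → ∃ S' ≤ S, IsTinyZS S'}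

/-- `etaC G` : the smallest `t ≥ 1` such that every sequence over `G` of length `≥ t`
    contains a non-empty zero-sum subsequence of length at most `exp(G)`. -/
noncomputable def etaC (G : Type*) [AddCommGroup G] : ℕ :=
  sInf {t : ℕ | 0 < t ∧ ∀ S : Multiset G, t ≤ Multiset.card S →
    ∃ S' ≤ S, S' ≠ 0 ∧ S'.sum = 0 ∧ Multiset.card S' ≤ AddMonoid.exponent G}

/-- `etaDD G d' d` : the smallest `t ≥ 1` such that every sequence over
    `G_d = {x : G | d • x = 0}` of length `≥ t` contains a non-empty subsequence of length
    at most `d'` whose sum lies in `G_{d/d'}`. -/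
noncomputable def etaDD (G : Type*) [AddCommGroup G] (d' d : ℕ) : ℕ :=
  sInf {t : ℕ | 0 < t ∧ ∀ S : Multiset G, (∀ g ∈ S, d • g = 0) → t ≤ Multiset.card S →
    ∃ S' ≤ S, S' ≠ 0 ∧ Multiset.card S' ≤ d' ∧ (d / d') • S'.sum = 0}

/-- `rhoC G` : the maximum of the cross numbers of sequences over `G` containing
    no tiny zero-sum subsequence. -/
noncomputable def rhoC (G : Type*) [AddCommGroup G] : ℝ :=
  sSup {x : ℝ | ∃ S : Multiset G, (¬ ∃ S' ≤ S, IsTinyZS S') ∧ crossNum S = x}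

/-- `maxPF n = P⁺(n)`, the greatest prime divisor of `n`, with `P⁺(1) = 1`. -/
def maxPF (n : ℕ) : ℕ := if n = 1 then 1 else n.primeFactors.sup id

/-- `G` is a finite abelian group of rank `r`, i.e. `G ≅ C_{n₁} ⊕ ⋯ ⊕ C_{n_r}` with
    `1 < n₁ ∣ ⋯ ∣ n_r`. -/
def HasRank (G : Type*) [AddCommGroup G] (r : ℕ) : Prop :=
  ∃ n : Fin r → ℕ, (∀ i, 1 < n i) ∧ (∀ i j : Fin r, i ≤ j → n i ∣ n j) ∧
    Nonempty (G ≃+ ((i : Fin r) → ZMod (n i)))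

/-- Every finite sequence that is long enough has a short non-empty zero-sum subsequence. -/
theorem etaC_spec (H : Type*) [AddCommGroup H] [Finite H] (S : Multiset H)
    (hS : etaC H ≤ Multiset.card S) :
    ∃ S' ≤ S, S' ≠ 0 ∧ S'.sum = 0 ∧ Multiset.card S' ≤ AddMonoid.exponent H := by
  classical
  cases nonempty_fintype H
  have hne : {t : ℕ | 0 < t ∧ ∀ S : Multiset H, t ≤ Multiset.card S →
      ∃ S' ≤ S, S' ≠ 0 ∧ S'.sum = 0 ∧ Multiset.card S' ≤ AddMonoid.exponent H}.Nonempty := by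
    have hpos : 0 < AddMonoid.exponent H := AddMonoid.exponent_pos.2 AddMonoid.ExponentExists.of_finite
    refine ⟨Fintype.card H * AddMonoid.exponent H, Nat.mul_pos Fintype.card_pos hpos, fun S hS => ?_⟩
    obtain ⟨g, hg⟩ : ∃ g, AddMonoid.exponent H ≤ S.count g := by
      by_contra! h
      have h1 : Multiset.card S = ∑ g : H, S.count g :=
        (Multiset.sum_count_eq_card (fun a _ => Finset.mem_univ a)).symm
      have h2 : ∑ g : H, S.count g < ∑ _g : H, AddMonoid.exponent H :=
        Finset.sum_lt_sum_of_nonempty Finset.univ_nonempty (fun g _ => h g)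
      simp at h2
      omega
    refine ⟨Multiset.replicate (AddMonoid.exponent H) g, Multiset.le_count_iff_replicate_le.1 hg,
      ?_, ?_, ?_⟩
    · intro h
      have := congrArg Multiset.card h
      simp at this
      omega
    · simp [AddMonoid.exponent_nsmul_eq_zero]
    · simp
  exact (Nat.sInf_mem hne).2 S hS

theorem Multiset.exists_le_map_eq {α β : Type*} (f : α → β) (S : Multiset α) (U : Multiset β)
    (h : U ≤ S.map f) : ∃ T ≤ S, T.map f = U := by
  classical
  induction S using Multiset.induction_on generalizing U with
  | empty => exact ⟨0, le_rfl, by simpa using (Multiset.le_zero.1 (by simpa using h)).symm⟩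
  | cons a S ih =>
    rw [Multiset.map_cons] at h
    by_cases ha : f a ∈ U
    · obtain ⟨V, rfl⟩ := Multiset.exists_cons_of_mem ha
      obtain ⟨T, hT, rfl⟩ := ih V ((Multiset.cons_le_cons_iff _).1 h)
      exact ⟨a ::ₘ T, Multiset.cons_le_cons _ hT, by simp⟩
    · obtain ⟨T, hT, rfl⟩ := ih U ((Multiset.le_cons_of_notMem ha).1 h)
      exact ⟨T, hT.trans (Multiset.le_cons_self _ _), rfl⟩

/-- A sequence longer than `c * (d' - 1)` over the `d`-torsion of a group of rank `r` has a
non-empty subsequence of length at most `d'` whose sum is `d / d'`-torsion. -/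
theorem exists_short_sum_torsion {r : ℕ} {c : ℝ}
    (hc : ∀ m : ℕ, 0 < m → (etaC (Fin r → ZMod m) : ℝ) ≤ c * ((m : ℝ) - 1) + 1)
    {G : Type*} [AddCommGroup G] (hG : HasRank G r) {d' e : ℕ} (hd' : 0 < d')
    (S : Multiset G) (hS : ∀ g ∈ S, (d' * e) • g = 0)
    (hcard : c * ((d' : ℝ) - 1) < Multiset.card S) :
    ∃ T ≤ S, T ≠ 0 ∧ Multiset.card T ≤ d' ∧ e • T.sum = 0 := by
  obtain ⟨n, hn, -, ⟨ψ⟩⟩ := hG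
  have : NeZero d' := ⟨hd'.ne'⟩
  have hn' : ∀ i, NeZero (n i) := fun i => ⟨(zero_lt_one.trans (hn i)).ne'⟩
  let y : G → Fin r → ℕ := fun g i => d' * e * (ψ g i).val / n i
  let φ : G → Fin r → ZMod d' := fun g i => (y g i : ZMod d')
  have hle : etaC (Fin r → ZMod d') ≤ Multiset.card (S.map φ) := by
    have h1 := hc d' hd'
    have h2 : (etaC (Fin r → ZMod d') : ℝ) < (Multiset.card S + 1 : ℕ) := by
      push_cast; linarith
    rw [Multiset.card_map]
    exact Nat.lt_succ_iff.1 (by exact_mod_cast h2)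
  obtain ⟨U, hU, hU0, hUs, hUc⟩ := etaC_spec _ _ hle
  obtain ⟨T, hT, rfl⟩ := Multiset.exists_le_map_eq φ S U hU
  refine ⟨T, hT, fun h => hU0 (by simp [h]), ?_, ?_⟩
  · rw [Multiset.card_map] at hUc
    refine hUc.trans (Nat.le_of_dvd hd' (AddMonoid.exponent_dvd_of_forall_nsmul_eq_zero fun g => ?_))
    ext i
    simp
  · have hsum : ∀ V : Multiset G, (∀ g ∈ V, (d' * e) • g = 0) → ∀ i,
        n i * (V.map (y · i)).sum = d' * e * (V.map fun g => (ψ g i).val).sum := by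
      intro V hV i
      rw [← Multiset.sum_map_mul_left, ← Multiset.sum_map_mul_left]
      refine congrArg _ (Multiset.map_congr rfl fun g hg => Nat.mul_div_cancel' ?_)
      rw [← ZMod.natCast_eq_zero_iff]
      have := congrFun (congrArg ψ (hV g hg)) i
      simpa using this
    apply ψ.injective
    ext i
    have h0 : ((T.map (y · i)).sum : ZMod d') = 0 := by
      have h := map_multiset_sum (Pi.evalAddMonoidHom (fun _ : Fin r => ZMod d') i) (T.map φ)
      rw [hUs, _root_.map_zero, Multiset.map_map] at h
      simpa [φ, Multiset.map_map, Function.comp_def] using h.symm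
    rw [ZMod.natCast_eq_zero_iff] at h0
    obtain ⟨k, hk⟩ := h0
    have h1 := hsum T (fun g hg => hS g (Multiset.mem_of_le hT hg)) i
    rw [hk] at h1
    have h2 : n i * k = e * (T.map fun g => (ψ g i).val).sum :=
      Nat.eq_of_mul_eq_mul_left hd' (by linarith)
    have h3 := congrArg (Nat.cast : ℕ → ZMod (n i)) h2
    have h4 : ψ T.sum i = (((T.map fun g => (ψ g i).val).sum : ℕ) : ZMod (n i)) := by
      have h := map_multiset_sum
        ((Pi.evalAddMonoidHom (fun i : Fin r => ZMod (n i)) i).comp ψ.toAddMonoidHom) T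
      simpa [Multiset.map_map, Function.comp_def] using h
    push_cast at h3
    simp [h4] at h3 ⊢
    exact h3.symm

/-- A weighted sequence in which every non-empty zero-sum subsequence has weight above `1`. -/
def NoTiny {G : Type*} [AddCommGroup G] (S : Multiset (G × ℝ)) : Prop :=
  ∀ W ≤ S, W ≠ 0 → W.sum.1 = 0 → 1 < W.sum.2

theorem NoTiny.mono {G : Type*} [AddCommGroup G] {S T : Multiset (G × ℝ)} (hS : NoTiny S)
    (h : T ≤ S) : NoTiny T :=
  fun W hW => hS W (hW.trans h)

theorem NoTiny.merge {G : Type*} [AddCommGroup G] {A T : Multiset (G × ℝ)} (hT : T ≠ 0)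
    (h : NoTiny (T + A)) : NoTiny (T.sum ::ₘ A) := by
  intro W hW hW0 hs
  by_cases hm : T.sum ∈ W
  · obtain ⟨V, rfl⟩ := Multiset.exists_cons_of_mem hm
    have hV := (Multiset.cons_le_cons_iff _).1 hW
    have := h (T + V) (by gcongr) (by simp [hT]) (by simpa using hs)
    simpa using this
  · exact h W (((Multiset.le_cons_of_notMem hm).1 hW).trans (Multiset.le_add_left _ _)) hW0 hs

/-- Merging short subsequences of a sequence of `d' * e`-torsion elements into `e`-torsion elements
until at most `c * (d' - 1)` of the original elements remain. -/
theorem exists_merge {r : ℕ} {c : ℝ}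
    (hc : ∀ m : ℕ, 0 < m → (etaC (Fin r → ZMod m) : ℝ) ≤ c * ((m : ℝ) - 1) + 1)
    {G : Type*} [AddCommGroup G] (hG : HasRank G r) {d' e : ℕ} (hd' : 0 < d') {u : ℝ} (hu : 0 ≤ u)
    (S : Multiset (G × ℝ)) (hS : ∀ x ∈ S, (d' * e) • x.1 = 0 ∧ 0 ≤ x.2 ∧ x.2 ≤ u) :
    ∃ B : Multiset (G × ℝ), S.sum.2 ≤ c * ((d' : ℝ) - 1) * u + B.sum.2 ∧
      (∀ x ∈ B, e • x.1 = 0 ∧ 0 ≤ x.2 ∧ x.2 ≤ d' * u) ∧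
      ∀ A, NoTiny (S + A) → NoTiny (B + A) := by
  classical
  have hsnd : ∀ T : Multiset (G × ℝ), T.sum.2 = (T.map Prod.snd).sum := fun T =>
    map_multiset_sum (AddMonoidHom.snd G ℝ) T
  have hfst : ∀ T : Multiset (G × ℝ), T.sum.1 = (T.map Prod.fst).sum := fun T =>
    map_multiset_sum (AddMonoidHom.fst G ℝ) T
  have hub : ∀ T ≤ S, T.sum.2 ≤ Multiset.card T * u := by
    intro T hT
    rw [hsnd]
    have := Multiset.sum_le_card_nsmul (T.map Prod.snd) u (by
      simp only [Multiset.mem_map]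
      rintro _ ⟨x, hx, rfl⟩
      exact (hS x (Multiset.mem_of_le hT hx)).2.2)
    simpa using this
  induction hN : Multiset.card S using Nat.strong_induction_on generalizing S with
  | _ N ih =>
    by_cases hle : (Multiset.card S : ℝ) ≤ c * ((d' : ℝ) - 1)
    · refine ⟨0, ?_, by simp, fun A hA => hA.mono (by simp)⟩
      have := hub S le_rfl
      have h2 := mul_le_mul_of_nonneg_right hle hu
      simp only [Multiset.sum_zero, Prod.snd_zero]
      linarith
    · obtain ⟨U, hU, hU0, hUc, hUs⟩ := exists_short_sum_torsion hc hG hd' (e := e) (S.map Prod.fst)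
        (by
          simp only [Multiset.mem_map]
          rintro _ ⟨x, hx, rfl⟩
          exact (hS x hx).1) (by simpa using hle)
      obtain ⟨T, hT, rfl⟩ := Multiset.exists_le_map_eq _ _ _ hU
      obtain ⟨S', rfl⟩ := Multiset.le_iff_exists_add.1 hT
      have hT0 : T ≠ 0 := by rintro rfl; simp at hU0
      obtain ⟨B, hB1, hB2, hB3⟩ := ih (Multiset.card S') (by
          have := Multiset.card_pos.2 hT0
          rw [← hN, Multiset.card_add]; omega) S'
        (fun x hx => hS x (Multiset.mem_add.2 (.inr hx)))
        (fun V hV => hub V (hV.trans (Multiset.le_add_left _ _))) rfl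
      refine ⟨T.sum ::ₘ B, ?_, ?_, fun A hA => ?_⟩
      · simp only [Multiset.sum_add, Multiset.sum_cons, Prod.snd_add]
        linarith
      · intro x hx
        rcases Multiset.mem_cons.1 hx with rfl | hx
        · refine ⟨by rw [hfst]; exact hUs, ?_, (hub T hT).trans ?_⟩
          · rw [hsnd]
            apply Multiset.sum_nonneg
            simp only [Multiset.mem_map]
            rintro _ ⟨x, hx, rfl⟩
            exact (hS x (Multiset.mem_of_le hT hx)).2.1
          · gcongr
            simpa using hUc
        · exact hB2 x hx
      · have h1 : NoTiny (T + (S' + A)) := by rwa [← add_assoc]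
        have h2 := h1.merge hT0
        have h3 : NoTiny (S' + (T.sum ::ₘ A)) := by simpa using h2
        simpa using hB3 _ h3

/-- The weight of a tiny-free weighted sequence over the `p ^ a`-torsion. -/
theorem NoTiny.weight_le {r : ℕ} {c : ℝ}
    (hc : ∀ m : ℕ, 0 < m → (etaC (Fin r → ZMod m) : ℝ) ≤ c * ((m : ℝ) - 1) + 1)
    {G : Type*} [AddCommGroup G] (hG : HasRank G r) {p : ℕ} (hp : p.Prime) (a : ℕ)
    (S : Multiset (G × ℝ)) (hS : NoTiny S)
    (h : ∀ x ∈ S, p ^ a • x.1 = 0 ∧ 0 ≤ x.2 ∧ x.2 ≤ 1 / addOrderOf x.1) :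
    S.sum.2 ≤ c * (1 - 1 / (p : ℝ) ^ a) := by
  classical
  have hp0 : (0 : ℝ) < p := by exact_mod_cast hp.pos
  induction a generalizing S with
  | zero =>
    have : S = 0 := by
      refine Multiset.eq_zero_of_forall_notMem fun x hx => ?_
      obtain ⟨h1, -, h2⟩ := h x hx
      have hx0 : x.1 = 0 := by simpa using h1
      have := hS {x} (by simpa using hx) (by simp) (by simpa using hx0)
      simp [hx0] at h2 this
      linarith
    simp [this]
  | succ a ih =>
    have hu : (0 : ℝ) ≤ 1 / (p : ℝ) ^ (a + 1) := by positivity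
    obtain ⟨B, hB1, hB2, hB3⟩ := exists_merge hc hG (d' := p) (e := p ^ a) hp.pos hu
      (S.filter fun x => ¬ p ^ a • x.1 = 0) (by
        intro x hx
        obtain ⟨hx, hxa⟩ := Multiset.mem_filter.1 hx
        obtain ⟨h1, h2, h3⟩ := h x hx
        have : Fact p.Prime := ⟨hp⟩
        rw [addOrderOf_eq_prime_pow hxa h1] at h3
        exact ⟨by rwa [← pow_succ'], h2, by simpa using h3⟩)
    have hsplit := Multiset.filter_add_not (fun x : G × ℝ => p ^ a • x.1 = 0) S
    have h1 := ih (B + S.filter fun x => p ^ a • x.1 = 0)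
      (hB3 _ (by rwa [add_comm, hsplit])) (by
        intro x hx
        rcases Multiset.mem_add.1 hx with hx | hx
        · obtain ⟨h1, h2, h3⟩ := hB2 x hx
          refine ⟨h1, h2, h3.trans ?_⟩
          have hd : addOrderOf x.1 ∣ p ^ a := addOrderOf_dvd_of_nsmul_eq_zero h1
          have hle : (addOrderOf x.1 : ℝ) ≤ (p : ℝ) ^ a := by
            exact_mod_cast Nat.le_of_dvd (pow_pos hp.pos a) hd
          have hpos : (0 : ℝ) < addOrderOf x.1 := by
            exact_mod_cast Nat.pos_of_dvd_of_pos hd (pow_pos hp.pos a)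
          calc (p : ℝ) * (1 / (p : ℝ) ^ (a + 1)) = 1 / (p : ℝ) ^ a := by field_simp; ring
            _ ≤ _ := one_div_le_one_div_of_le hpos hle
        · obtain ⟨hx, hxa⟩ := Multiset.mem_filter.1 hx
          exact ⟨hxa, (h x hx).2⟩)
    have h2 := congrArg (fun V : Multiset (G × ℝ) => V.sum.2) hsplit
    simp only [Multiset.sum_add, Prod.snd_add] at h1 h2
    have h3 : c * ((p : ℝ) - 1) * (1 / (p : ℝ) ^ (a + 1))
        = c * (1 / (p : ℝ) ^ a - 1 / (p : ℝ) ^ (a + 1)) := by field_simp; ring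
    linarith

theorem NoTiny.sum_of_forall {G ι : Type*} [AddCommGroup G] (D : Finset ι)
    (S B : ι → Multiset (G × ℝ))
    (h : ∀ i ∈ D, ∀ A, NoTiny (S i + A) → NoTiny (B i + A)) (A : Multiset (G × ℝ))
    (hS : NoTiny (∑ i ∈ D, S i + A)) : NoTiny (∑ i ∈ D, B i + A) := by
  classical
  induction D using Finset.induction_on generalizing A with
  | empty => simpa using hS
  | insert j D hj ih =>
    rw [Finset.sum_insert hj] at hS ⊢
    have h1 := h j (Finset.mem_insert_self _ _) (∑ i ∈ D, S i + A) (by rwa [← add_assoc])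
    have h2 := ih (fun i hi => h i (Finset.mem_insert_of_mem hi)) (B j + A)
      (by rwa [add_left_comm])
    rwa [add_comm (B j), add_assoc]

theorem maxPF_mem {d : ℕ} (h0 : d ≠ 0) (h1 : d ≠ 1) : maxPF d ∈ d.primeFactors := by
  rw [maxPF, if_neg h1]
  obtain ⟨p, hp, h⟩ := Finset.exists_mem_eq_sup d.primeFactors (by
    rw [Nat.nonempty_primeFactors]; omega) id
  rwa [h]

theorem le_maxPF {d q : ℕ} (h : q ∈ d.primeFactors) : q ≤ maxPF d := by
  have h1 : d ≠ 1 := by rintro rfl; simp at h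
  rw [maxPF, if_neg h1]
  exact Finset.le_sup (f := id) h

theorem le_prod_filter_le_maxPF {n d : ℕ} (hn : n ≠ 0) (hd : d ∣ n) :
    d ≤ ∏ q ∈ n.primeFactors with q ≤ maxPF d, q ^ n.factorization q := by
  have hd0 : d ≠ 0 := ne_zero_of_dvd_ne_zero hn hd
  have hsub : d.primeFactors ⊆ n.primeFactors.filter (· ≤ maxPF d) := fun q hq =>
    Finset.mem_filter.2 ⟨Nat.primeFactors_mono hd hn hq, le_maxPF hq⟩
  calc d = ∏ q ∈ d.primeFactors, q ^ d.factorization q :=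
        (Nat.prod_factorization_pow_eq_self hd0).symm
    _ ≤ ∏ q ∈ d.primeFactors, q ^ n.factorization q := by
        refine Finset.prod_le_prod' fun q hq => Nat.pow_le_pow_right ?_ ?_
        · exact (Nat.prime_of_mem_primeFactors hq).pos
        · exact (Nat.factorization_le_iff_dvd hd0 hn).2 hd q
    _ ≤ _ := by
        refine Finset.prod_le_prod_of_subset_of_one_le' hsub fun q hq _ => ?_
        exact Nat.pow_pos (Nat.prime_of_mem_primeFactors (Finset.mem_filter.1 hq).1).pos

theorem sum_prod_filter_le_primeFactors {n : ℕ} (hn : n ≠ 0) :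
    ∑ p ∈ n.primeFactors, (∏ q ∈ n.primeFactors with q ≤ p, (q : ℝ) ^ n.factorization q) *
      (1 - 1 / (p : ℝ) ^ n.factorization p) = n - 1 := by
  have h := Finset.prod_one_add_ordered n.primeFactors
    (fun q => (q : ℝ) ^ n.factorization q - 1)
  have h1 : ∏ q ∈ n.primeFactors, (q : ℝ) ^ n.factorization q = n := by
    exact_mod_cast Nat.prod_factorization_pow_eq_self hn
  simp only [add_sub_cancel] at h
  rw [h1] at h
  rw [h, add_sub_cancel_left]
  refine Finset.sum_congr rfl fun p hp => ?_
  have hins : n.primeFactors.filter (· ≤ p) = insert p (n.primeFactors.filter (· < p)) := by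
    ext q
    simp only [Finset.mem_filter, Finset.mem_insert, le_iff_lt_or_eq]
    constructor
    · rintro ⟨h, h | h⟩ <;> simp_all
    · rintro (rfl | h)
      · exact ⟨hp, .inr rfl⟩
      · exact ⟨h.1, .inl h.2⟩
  rw [hins, Finset.prod_insert (by simp)]
  have hp0 : (p : ℝ) ^ n.factorization p ≠ 0 := by
    have := (Nat.prime_of_mem_primeFactors hp).ne_zero
    positivity
  field_simp

theorem sum_filter_eq_self {α ι : Type*} [DecidableEq ι] (D : Finset ι) (f : α → ι)
    (S : Multiset α) (h : ∀ x ∈ S, f x ∈ D) :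
    ∑ d ∈ D, S.filter (fun x => f x = d) = S := by
  classical
  ext x
  rw [Multiset.count_sum']
  by_cases hx : x ∈ S
  · simp [Multiset.count_filter, h x hx]
  · simp [Multiset.count_filter, Multiset.count_eq_zero_of_notMem hx]

theorem sum_filter_le {α ι : Type*} [DecidableEq ι] (D : Finset ι) (f : α → ι)
    (S : Multiset α) : ∑ d ∈ D, S.filter (fun x => f x = d) ≤ S := by
  classical
  rw [Multiset.le_iff_count]
  intro x
  rw [Multiset.count_sum']
  by_cases hx : f x ∈ D <;> simp [Multiset.count_filter, hx]

/-- The length of a sequence without tiny zero-sum subsequences. -/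
theorem card_le_of_noTiny {r : ℕ} {c : ℝ}
    (hc : ∀ m : ℕ, 0 < m → (etaC (Fin r → ZMod m) : ℝ) ≤ c * ((m : ℝ) - 1) + 1)
    {G : Type*} [AddCommGroup G] (hG : HasRank G r) {n : ℕ} (hn : n ≠ 0)
    (hexp : ∀ g : G, addOrderOf g ∣ n) (S : Multiset G) (hS : ¬ ∃ S' ≤ S, IsTinyZS S') :
    (Multiset.card S : ℝ) ≤
      c * ∑ d ∈ n.divisors,
        (((d / (maxPF d) ^ (d.factorization (maxPF d)) : ℕ) : ℝ) - 1)
      + c * ((n : ℝ) - 1) := by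
  classical
  set m : ℕ → ℕ := fun d => d / (maxPF d) ^ (d.factorization (maxPF d)) with hm
  set e : ℕ → ℕ := fun d => (maxPF d) ^ (d.factorization (maxPF d)) with he
  have hme : ∀ d, m d * e d = d := fun d => Nat.div_mul_cancel (Nat.ordProj_dvd d _)
  let w : G → G × ℝ := fun g => (g, 1 / addOrderOf g)
  have hW : NoTiny (S.map w) := by
    intro W hW hW0 hs
    obtain ⟨T, hT, rfl⟩ := Multiset.exists_le_map_eq _ _ _ hW
    by_contra! hle
    refine hS ⟨T, hT, fun h => hW0 (by simp [h]), ?_, ?_⟩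
    · have := map_multiset_sum (AddMonoidHom.fst G ℝ) (T.map w)
      rw [Multiset.map_map] at this
      have hT : T.sum = (T.map w).sum.1 := by simpa [w, Function.comp_def] using this.symm
      rw [hT, hs]
    · have := map_multiset_sum (AddMonoidHom.snd G ℝ) (T.map w)
      rw [Multiset.map_map] at this
      rw [crossNum]
      simp only [w, Function.comp_def, AddMonoidHom.coe_snd] at this
      rw [← this]
      exact hle
  let P : ℕ → Multiset G := fun d => S.filter fun g => addOrderOf g = d
  have hPsum : ∀ d, ((P d).map w).sum.2 = Multiset.card (P d) * (1 / (d : ℝ)) := by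
    intro d
    have := map_multiset_sum (AddMonoidHom.snd G ℝ) ((P d).map w)
    rw [Multiset.map_map] at this
    refine this.trans ?_
    rw [Multiset.map_congr rfl (g := fun _ => 1 / (d : ℝ)) (fun g hg => by
      simp [w, (Multiset.mem_filter.1 hg).2])]
    simp
  have hex : ∀ d, ∃ B : Multiset (G × ℝ), d ≠ 0 →
      ((P d).map w).sum.2 ≤ c * ((m d : ℝ) - 1) * (1 / (d : ℝ)) + B.sum.2 ∧
      (∀ x ∈ B, e d • x.1 = 0 ∧ 0 ≤ x.2 ∧ x.2 ≤ m d * (1 / (d : ℝ))) ∧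
      ∀ A, NoTiny ((P d).map w + A) → NoTiny (B + A) := by
    intro d
    rcases eq_or_ne d 0 with rfl | hd
    · exact ⟨0, fun h => absurd rfl h⟩
    · obtain ⟨B, hB⟩ := exists_merge hc hG (d' := m d) (e := e d)
        (Nat.pos_of_ne_zero fun h => hd (by rw [← hme d, h, zero_mul]))
        (u := 1 / (d : ℝ)) (by positivity) ((P d).map w) (by
          simp only [Multiset.mem_map]
          rintro _ ⟨g, hg, rfl⟩
          have hgd := (Multiset.mem_filter.1 hg).2
          refine ⟨?_, by positivity, by simp [w, hgd]⟩
          rw [hme, ← hgd]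
          exact addOrderOf_nsmul_eq_zero g)
      exact ⟨B, fun _ => hB⟩
  choose B hB using hex
  have hP1 : Multiset.card (P 1) = 0 := by
    rw [Multiset.card_eq_zero]
    refine Multiset.eq_zero_of_forall_notMem fun g hg => ?_
    obtain ⟨hg, h1⟩ := Multiset.mem_filter.1 hg
    have hg0 : g = 0 := AddMonoid.addOrderOf_eq_one_iff.1 h1
    exact hS ⟨{g}, by simpa using hg, by simp, by simpa using hg0, by simp [crossNum, h1]⟩
  have hcard : (Multiset.card S : ℝ) = ∑ d ∈ n.divisors.erase 1, (Multiset.card (P d) : ℝ) := by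
    have h1 := congrArg Multiset.card (sum_filter_eq_self n.divisors addOrderOf S
      (fun g _ => Nat.mem_divisors.2 ⟨hexp g, hn⟩))
    rw [Multiset.card_sum, ← Finset.add_sum_erase _ _ (Nat.one_mem_divisors.2 hn)] at h1
    change Multiset.card (P 1) + ∑ d ∈ n.divisors.erase 1, Multiset.card (P d) = _ at h1
    rw [hP1, zero_add] at h1
    exact_mod_cast h1.symm
  have hmsum : ∑ d ∈ n.divisors, ((m d : ℝ) - 1) = ∑ d ∈ n.divisors.erase 1, ((m d : ℝ) - 1) := by
    rw [← Finset.add_sum_erase _ _ (Nat.one_mem_divisors.2 hn)]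
    simp [hm]
  have hmaps : ∀ d ∈ n.divisors.erase 1, maxPF d ∈ n.primeFactors := by
    intro d hd
    obtain ⟨h1, hd⟩ := Finset.mem_erase.1 hd
    have hd := (Nat.mem_divisors.1 hd).1
    exact Nat.primeFactors_mono hd hn (maxPF_mem (ne_zero_of_dvd_ne_zero hn hd) h1)
  have hprime : ∀ p ∈ n.primeFactors,
      ∑ d ∈ n.divisors.erase 1 with maxPF d = p, (Multiset.card (P d) : ℝ) ≤
        ∑ d ∈ n.divisors.erase 1 with maxPF d = p, c * ((m d : ℝ) - 1) +
        c * ((∏ q ∈ n.primeFactors with q ≤ p, (q : ℝ) ^ n.factorization q) *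
          (1 - 1 / (p : ℝ) ^ n.factorization p)) := by
    intro p hp
    have hpp := Nat.prime_of_mem_primeFactors hp
    set D := {d ∈ n.divisors.erase 1 | maxPF d = p} with hD
    set N : ℝ := ∏ q ∈ n.primeFactors with q ≤ p, (q : ℝ) ^ n.factorization q with hN
    have hDmem : ∀ d ∈ D, d ≠ 0 ∧ d ∣ n ∧ maxPF d = p := by
      intro d hd
      obtain ⟨hd, h2⟩ := Finset.mem_filter.1 hd
      have h3 := (Nat.mem_divisors.1 (Finset.mem_erase.1 hd).2).1
      exact ⟨ne_zero_of_dvd_ne_zero hn h3, h3, h2⟩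
    have hNT : NoTiny (∑ d ∈ D, B d) := by
      have := NoTiny.sum_of_forall D (fun d => (P d).map w) B
        (fun d hd => (hB d (hDmem d hd).1).2.2) 0 (by
          rw [add_zero]
          refine hW.mono ?_
          change ∑ d ∈ D, Multiset.mapAddMonoidHom w (P d) ≤ _
          rw [← map_sum]
          exact Multiset.map_le_map (sum_filter_le D addOrderOf S))
      simpa using this
    have hwt := hNT.weight_le hc hG hpp (n.factorization p) _ (by
      intro x hx
      obtain ⟨d, hd, hx⟩ := Multiset.mem_sum.1 hx
      obtain ⟨hd0, hdn, hdp⟩ := hDmem d hd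
      obtain ⟨h1, h2, h3⟩ := (hB d hd0).2.1 x hx
      have hed : e d ∣ p ^ n.factorization p := by
        simp only [he, hdp]
        exact pow_dvd_pow p ((Nat.factorization_le_iff_dvd hd0 hn).2 hdn p)
      have hme0 : m d ≠ 0 ∧ e d ≠ 0 := by
        rw [← mul_ne_zero_iff, hme]; exact hd0
      refine ⟨?_, h2, h3.trans ?_⟩
      · obtain ⟨k, hk⟩ := hed
        rw [hk, mul_comm, mul_smul, h1, smul_zero]
      · have hdvd := addOrderOf_dvd_of_nsmul_eq_zero h1
        have hpos : 0 < addOrderOf x.1 := Nat.pos_of_dvd_of_pos hdvd (Nat.pos_of_ne_zero hme0.2)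
        have hle := Nat.le_of_dvd (Nat.pos_of_ne_zero hme0.2) hdvd
        have hdr : (d : ℝ) = m d * e d := by exact_mod_cast (hme d).symm
        have hm0 : (m d : ℝ) ≠ 0 := by exact_mod_cast hme0.1
        calc (m d : ℝ) * (1 / (d : ℝ)) = 1 / (e d : ℝ) := by
              rw [hdr]; field_simp
          _ ≤ _ := one_div_le_one_div_of_le (by exact_mod_cast hpos) (by exact_mod_cast hle))
    have hBsum : (∑ d ∈ D, B d).sum.2 = ∑ d ∈ D, (B d).sum.2 :=
      map_sum ((AddMonoidHom.snd G ℝ).comp Multiset.sumAddMonoidHom) B D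
    rw [hBsum] at hwt
    have hN0 : 0 ≤ N := by positivity
    have hstep : ∀ d ∈ D, (Multiset.card (P d) : ℝ) ≤ c * ((m d : ℝ) - 1) + N * (B d).sum.2 := by
      intro d hd
      obtain ⟨hd0, hdn, hdp⟩ := hDmem d hd
      obtain ⟨h1, h2, -⟩ := hB d hd0
      rw [hPsum] at h1
      have hdN : (d : ℝ) ≤ N := by
        have := le_prod_filter_le_maxPF hn hdn
        rw [hdp] at this
        rw [hN]
        exact_mod_cast this
      have hB0 : 0 ≤ (B d).sum.2 := by
        have := map_multiset_sum (AddMonoidHom.snd G ℝ) (B d)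
        refine le_of_le_of_eq ?_ this.symm
        apply Multiset.sum_nonneg
        simp only [Multiset.mem_map]
        rintro _ ⟨x, hx, rfl⟩
        exact (h2 x hx).2.1
      have hdr : (0 : ℝ) < d := by exact_mod_cast Nat.pos_of_ne_zero hd0
      have h3 := mul_le_mul_of_nonneg_left h1 hdr.le
      have h4 : (d : ℝ) * (Multiset.card (P d) * (1 / (d : ℝ))) = Multiset.card (P d) := by
        field_simp
      have h5 : (d : ℝ) * (c * ((m d : ℝ) - 1) * (1 / (d : ℝ)) + (B d).sum.2)
          = c * ((m d : ℝ) - 1) + d * (B d).sum.2 := by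
        field_simp
      have h6 := mul_le_mul_of_nonneg_right hdN hB0
      linarith
    have h1 := Finset.sum_le_sum hstep
    rw [Finset.sum_add_distrib, ← Finset.mul_sum D _ N] at h1
    have h2 := mul_le_mul_of_nonneg_left hwt hN0
    linarith
  have hfin := Finset.sum_le_sum hprime
  rw [Finset.sum_add_distrib, Finset.sum_fiberwise_of_maps_to hmaps,
    Finset.sum_fiberwise_of_maps_to hmaps, ← Finset.mul_sum, ← Finset.mul_sum,
    sum_prod_filter_le_primeFactors hn, ← hcard, ← hmsum] at hfin
  exact hfin

/-- **Main theorem.** If `η(C_m^r) ≤ c(m-1)+1` for all `m ≥ 1`, then every finite abelian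
group `G` of rank `r` and exponent `n` satisfies
`t(G) ≤ c ⬝ ∑_{d ∣ n} (d / P⁺(d)^{ν_{P⁺(d)}(d)} - 1) + c(n-1) + 1`. -/
theorem stmt13 (r : ℕ) (hr : 0 < r) (c : ℝ) (hc0 : 0 < c)
    (hc : ∀ m : ℕ, 0 < m → (etaC (Fin r → ZMod m) : ℝ) ≤ c * ((m : ℝ) - 1) + 1)
    (G : Type*) [AddCommGroup G] [Fintype G] (hG : HasRank G r)
    (n : ℕ) (hn : AddMonoid.exponent G = n) :
    (tC G : ℝ) ≤
      c * ∑ d ∈ n.divisors,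
        (((d / (maxPF d) ^ (d.factorization (maxPF d)) : ℕ) : ℝ) - 1)
      + c * ((n : ℝ) - 1) + 1 := by
  have hn0 : n ≠ 0 := by
    rw [← hn]
    exact AddMonoid.exponent_ne_zero_of_finite
  have hexp : ∀ g : G, addOrderOf g ∣ n := fun g => hn ▸ AddMonoid.addOrder_dvd_exponent g
  have key := card_le_of_noTiny hc hG hn0 hexp
  rcases Nat.lt_or_ge (tC G) 2 with h | h
  · have h0 := key 0 (by
      rintro ⟨S', hS', h0, -⟩
      exact h0 (by simpa using hS'))
    have h1 : (tC G : ℝ) ≤ 1 := by exact_mod_cast Nat.le_of_lt_succ h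
    simp only [Multiset.card_zero, Nat.cast_zero] at h0
    linarith
  · have hnot := Nat.notMem_of_lt_sInf (show tC G - 1 < tC G by omega)
    simp only [Set.mem_ofPred_eq, not_and, not_forall] at hnot
    obtain ⟨S, hS, hS'⟩ := hnot (by omega)
    have h0 := key S hS'
    have h1 : (tC G : ℝ) ≤ Multiset.card S + 1 := by
      have : tC G ≤ Multiset.card S + 1 := by omega
      exact_mod_cast this
    linarith
end

section
/- For every integer ℓ ≥ 1, one has Π_{i=1}^{ℓ} (1 + 1/(p_i − 1)) ≤ p_{ℓ+1} − 1, where p_1 = 2 < p_2 = 3 < ⋯ is the increasing sequence of all prime numbers. -/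
open Multiset Finset

/-- `∏_{i=1}^{ℓ} (1 + 1/(p_i - 1)) ≤ p_{ℓ+1} - 1`, where `p_i` is the `i`-th prime
(so `p_1 = 2`, i.e. `p_i = Nat.nth Nat.Prime (i-1)`). -/
theorem stmt15 (ℓ : ℕ) (hℓ : 1 ≤ ℓ) :
    ∏ i ∈ Finset.range ℓ, (1 + 1 / ((Nat.nth Nat.Prime i : ℝ) - 1)) ≤
      (Nat.nth Nat.Prime ℓ : ℝ) - 1 := by
  induction ℓ, hℓ using Nat.le_induction with
  | base => norm_num [Nat.nth_prime_zero_eq_two, Nat.nth_prime_one_eq_three]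
  | succ n _ ih =>
    have hpos : (0 : ℝ) < (Nat.nth Nat.Prime n : ℝ) - 1 :=
      sub_pos.mpr (by exact_mod_cast (Nat.prime_nth_prime n).one_lt)
    have hlt : Nat.nth Nat.Prime n < Nat.nth Nat.Prime (n + 1) :=
      Nat.nth_strictMono Nat.infinite_setOfPred_prime n.lt_succ_self
    have hle : (Nat.nth Nat.Prime n : ℝ) + 1 ≤ Nat.nth Nat.Prime (n + 1) := by
      exact_mod_cast hlt
    rw [Finset.prod_range_succ]
    calc
      _ ≤ ((Nat.nth Nat.Prime n : ℝ) - 1) * (1 + 1 / ((Nat.nth Nat.Prime n : ℝ) - 1)) := by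
        gcongr
      _ = Nat.nth Nat.Prime n := by
        field_simp
        ring
      _ ≤ _ := by linarith
end

section
/- Define the arithmetic function f(n) = Σ_{d ∣ n} d / P^+(d). Then for every integer n ≥ 1, one has f(n) ≤ n. -/
open Multiset Finset

/-- Splitting off the largest prime: an induction principle for natural numbers. -/
theorem Nat.recOn_largest_prime {motive : ℕ → Prop} (zero : motive 0)
    (one : motive 1)
    (step : ∀ p a m : ℕ, p.Prime → m ≠ 0 → (∀ q, q.Prime → q ∣ m → q < p) → motive m →
      motive (p ^ (a + 1) * m)) (n : ℕ) : motive n := by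
  induction n using Nat.strong_induction_on with
  | _ n ih =>
    rcases eq_or_ne n 0 with rfl | hn
    · exact zero
    rcases eq_or_ne n 1 with rfl | h1
    · exact one
    have hne : n.primeFactors.Nonempty := Nat.nonempty_primeFactors.2 (by lia)
    obtain ⟨p, hp, hmax⟩ := n.primeFactors.exists_max_image id hne
    have hpp := Nat.prime_of_mem_primeFactors hp
    obtain ⟨k, m, hpm, hnm⟩ := Nat.exists_eq_pow_mul_and_not_dvd hn p hpp.ne_one
    have hm0 : m ≠ 0 := by rintro rfl; simp at hpm
    obtain _ | a := k
    · rw [pow_zero, one_mul] at hnm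
      exact absurd (Nat.dvd_of_mem_primeFactors hp) (hnm ▸ hpm)
    have hlt : m < n := by
      rw [hnm]
      exact lt_mul_of_one_lt_left (Nat.pos_of_ne_zero hm0)
        (Nat.one_lt_pow (Nat.succ_ne_zero a) hpp.one_lt)
    rw [hnm]
    refine step p a m hpp hm0 (fun q hq hqm => ?_) (ih m hlt)
    have hqn : q ∈ n.primeFactors :=
      Nat.mem_primeFactors.2 ⟨hq, hnm ▸ hqm.mul_left _, hn⟩
    exact lt_of_le_of_ne (hmax q hqn) (by rintro rfl; exact hpm hqm)

theorem Nat.coprime_of_forall_prime_dvd_lt {p m : ℕ} (hp : p.Prime)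
    (hlt : ∀ q, q.Prime → q ∣ m → q < p) : p.Coprime m :=
  (Nat.Prime.coprime_iff_not_dvd hp).2 fun h => (hlt p hp h).false

/-- Divisors of `p ^ k * m` with `p ∤ m` are the products `p ^ i * e`, `i ≤ k`, `e ∣ m`. -/
theorem Nat.sum_divisors_prime_pow_mul {M : Type*} [AddCommMonoid M] {p m : ℕ} (hp : p.Prime)
    (hpm : p.Coprime m) (k : ℕ) (f : ℕ → M) :
    ∑ d ∈ (p ^ k * m).divisors, f d =
      ∑ i ∈ Finset.range (k + 1), ∑ e ∈ m.divisors, f (p ^ i * e) := by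
  rw [← Nat.sum_divisors_prime_pow (f := fun x => ∑ e ∈ m.divisors, f (x * e)) hp,
    ← Finset.sum_product', Nat.divisors_mul, Finset.mul_def,
    Finset.sum_image (Nat.Coprime.mul_injOn_divisors (hpm.pow_left k))]

/-- If all prime divisors of `n` are less than `P`, then `σ(n) ≤ n (P - 1)`. -/
theorem Nat.sum_divisors_le_mul_of_prime_dvd_lt (n : ℕ) :
    ∀ P : ℕ, 2 ≤ P → (∀ q, q.Prime → q ∣ n → q < P) →
      ∑ d ∈ n.divisors, (d : ℝ) ≤ n * (P - 1) := by
  induction n using Nat.recOn_largest_prime with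
  | zero => simp
  | one =>
    intro P hP _
    have : (2 : ℝ) ≤ P := by exact_mod_cast hP
    simp only [Nat.divisors_one, Finset.sum_singleton, Nat.cast_one]
    linarith
  | step p a m hp hm hlt ih =>
    intro P _ hlt'
    have hpP : (p : ℝ) + 1 ≤ P := by
      exact_mod_cast hlt' p hp (dvd_mul_of_dvd_left (dvd_pow_self p a.succ_ne_zero) m)
    have hσ := ih p hp.two_le hlt
    rw [Nat.sum_divisors_prime_pow_mul hp (Nat.coprime_of_forall_prime_dvd_lt hp hlt)]
    push_cast
    simp_rw [← Finset.mul_sum]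
    rw [← Finset.sum_mul]
    calc (∑ i ∈ Finset.range (a + 1 + 1), (p : ℝ) ^ i) * ∑ e ∈ m.divisors, (e : ℝ)
        ≤ (∑ i ∈ Finset.range (a + 1 + 1), (p : ℝ) ^ i) * (m * (p - 1)) := by gcongr
      _ = m * ((∑ i ∈ Finset.range (a + 1 + 1), (p : ℝ) ^ i) * (p - 1)) := by ring
      _ = m * ((p : ℝ) ^ (a + 1 + 1) - 1) := by rw [geom_sum_mul]
      _ ≤ m * ((p : ℝ) ^ (a + 1) * p) := by gcongr; rw [pow_succ]; linarith
      _ ≤ m * ((p : ℝ) ^ (a + 1) * (P - 1)) := by gcongr; linarith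
      _ = (p : ℝ) ^ (a + 1) * m * (P - 1) := by ring

theorem maxPF_prime_pow_succ_mul {p e : ℕ} (hp : p.Prime) (i : ℕ) (he : e ≠ 0)
    (hle : ∀ q, q.Prime → q ∣ e → q ≤ p) : maxPF (p ^ (i + 1) * e) = p := by
  have hdvd : p ∣ p ^ (i + 1) * e := dvd_mul_of_dvd_left (dvd_pow_self p i.succ_ne_zero) e
  have h0 : p ^ (i + 1) * e ≠ 0 := mul_ne_zero (pow_ne_zero _ hp.ne_zero) he
  have h1 : p ^ (i + 1) * e ≠ 1 := fun h => hp.one_lt.ne' (Nat.dvd_one.1 (h ▸ hdvd))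
  rw [maxPF, if_neg h1]
  refine le_antisymm (Finset.sup_le fun q hq => ?_)
    (Finset.le_sup (f := id) (Nat.mem_primeFactors.2 ⟨hp, hdvd, h0⟩))
  have hqp := Nat.prime_of_mem_primeFactors hq
  rcases hqp.dvd_mul.1 (Nat.dvd_of_mem_primeFactors hq) with h | h
  · exact Nat.le_of_dvd hp.pos (hqp.dvd_of_dvd_pow h)
  · exact hle q hqp h

/-- `f(n) = ∑_{d ∣ n} d / P⁺(d) ≤ n` for every `n ≥ 1`. -/
theorem stmt17 (n : ℕ) (hn : 1 ≤ n) :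
    ∑ d ∈ n.divisors, (d : ℝ) / (maxPF d : ℝ) ≤ (n : ℝ) := by
  clear hn
  induction n using Nat.recOn_largest_prime with
  | zero => simp
  | one => simp [maxPF]
  | step p a m hp hm hlt ih =>
    have hp0 : (p : ℝ) ≠ 0 := Nat.cast_ne_zero.2 hp.ne_zero
    have hσ := Nat.sum_divisors_le_mul_of_prime_dvd_lt m p hp.two_le hlt
    have hterm : ∀ i, ∑ e ∈ m.divisors, ((p ^ (i + 1) * e : ℕ) : ℝ) /
        (maxPF (p ^ (i + 1) * e) : ℝ) = (p : ℝ) ^ i * ∑ e ∈ m.divisors, (e : ℝ) := by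
      intro i
      rw [Finset.mul_sum]
      refine Finset.sum_congr rfl fun e he => ?_
      have hem := Nat.dvd_of_mem_divisors he
      rw [maxPF_prime_pow_succ_mul hp i (ne_zero_of_dvd_ne_zero hm hem)
        fun q hq hqe => (hlt q hq (hqe.trans hem)).le]
      push_cast
      field_simp
      ring
    rw [Nat.sum_divisors_prime_pow_mul hp (Nat.coprime_of_forall_prime_dvd_lt hp hlt),
      Finset.sum_range_succ', Finset.sum_congr rfl fun i _ => hterm i, ← Finset.sum_mul]
    simp only [pow_zero, one_mul]
    calc (∑ i ∈ Finset.range (a + 1), (p : ℝ) ^ i) * ∑ e ∈ m.divisors, (e : ℝ) +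
          ∑ e ∈ m.divisors, (e : ℝ) / (maxPF e : ℝ)
        ≤ (∑ i ∈ Finset.range (a + 1), (p : ℝ) ^ i) * (m * (p - 1)) + m := by gcongr
      _ = m * ((∑ i ∈ Finset.range (a + 1), (p : ℝ) ^ i) * (p - 1)) + m := by ring
      _ = ((p ^ (a + 1) * m : ℕ) : ℝ) := by rw [geom_sum_mul]; push_cast; ring
end

section
/- Let G be a finite abelian group such that t(G) = η(G). Then for every subgroup H of G, one has η(H) ≤ η(G). -/
open Multiset Finset

/-- The set of which `tC G` is the infimum is non-empty when `G` is finite: by pigeonhole, a long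
sequence contains some `g` repeated `addOrderOf g` times. -/
theorem exists_pos_forall_exists_isTinyZS (G : Type*) [AddCommGroup G] [Fintype G] :
    ∃ t : ℕ, 0 < t ∧ ∀ S : Multiset G, t ≤ Multiset.card S → ∃ S' ≤ S, IsTinyZS S' := by
  classical
  refine ⟨Fintype.card G * Fintype.card G + 1, Nat.succ_pos _, fun S hS => ?_⟩
  obtain ⟨g, hg⟩ : ∃ g : G, Fintype.card G < S.count g := by
    by_contra! hcount
    have hle : ∑ g : G, S.count g ≤ ∑ _g : G, Fintype.card G :=
      Finset.sum_le_sum fun g _ => hcount g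
    rw [Multiset.sum_count_eq_card fun g _ => Finset.mem_univ g] at hle
    simp only [Finset.sum_const, Finset.card_univ, smul_eq_mul] at hle
    omega
  have hpos : 0 < addOrderOf g := addOrderOf_pos g
  refine ⟨Multiset.replicate (addOrderOf g) g,
    Multiset.le_count_iff_replicate_le.mp (addOrderOf_le_card_univ.trans hg.le), ?_, ?_, ?_⟩
  · rw [← Multiset.card_pos, Multiset.card_replicate]
    exact hpos
  · rw [Multiset.sum_replicate, addOrderOf_nsmul_eq_zero]
  · have hne : (addOrderOf g : ℝ) ≠ 0 := by positivity
    simp [crossNum, hne]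

/-- A sequence of cross number at most `1` over a finite group is no longer than the exponent. -/
theorem card_le_exponent_of_crossNum_le_one {G : Type*} [AddCommGroup G] [Finite G]
    {S : Multiset G} (hS : crossNum S ≤ 1) : Multiset.card S ≤ AddMonoid.exponent G := by
  have hexp : 0 < AddMonoid.exponent G := AddMonoid.ExponentExists.of_finite.exponent_pos
  have hexp' : (0 : ℝ) < AddMonoid.exponent G := by exact_mod_cast hexp
  have hle : (Multiset.card S : ℝ) * (1 / AddMonoid.exponent G) ≤ crossNum S := by
    rw [← nsmul_eq_mul, ← Multiset.card_map (fun g : G => (1 : ℝ) / addOrderOf g) S]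
    refine Multiset.card_nsmul_le_sum fun x hx => ?_
    obtain ⟨g, -, rfl⟩ := Multiset.mem_map.mp hx
    have hpos : (0 : ℝ) < addOrderOf g := by exact_mod_cast addOrderOf_pos g
    refine one_div_le_one_div_of_le hpos ?_
    exact_mod_cast Nat.le_of_dvd hexp (AddMonoid.addOrder_dvd_exponent g)
  rw [mul_one_div] at hle
  exact_mod_cast (div_le_one hexp').mp (hle.trans hS)

/-- Injective homomorphisms preserve cross numbers. -/
theorem crossNum_map_of_injective {G K : Type*} [AddCommGroup G] [AddCommGroup K] (f : G →+ K)
    (hf : Function.Injective f) (S : Multiset G) : crossNum (S.map f) = crossNum S := by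
  simp [crossNum, Multiset.map_map, addOrderOf_injective f hf]

/-- Injective homomorphisms reflect tiny zero-sum sequences. -/
theorem IsTinyZS.of_map {G K : Type*} [AddCommGroup G] [AddCommGroup K] (f : G →+ K)
    (hf : Function.Injective f) {S : Multiset G} (hS : IsTinyZS (S.map f)) : IsTinyZS S := by
  obtain ⟨hne, hsum, hcross⟩ := hS
  refine ⟨?_, ?_, ?_⟩
  · rintro rfl
    exact hne (Multiset.map_zero f)
  · rwa [← map_multiset_sum, map_eq_zero_iff f hf] at hsum
  · rwa [crossNum_map_of_injective f hf] at hcross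

/-- A submultiset of an image is the image of a submultiset. -/
theorem exists_le_map_eq_of_le_map {α β : Type*} {f : α → β} {s : Multiset α} {t : Multiset β}
    (h : t ≤ s.map f) : ∃ u ≤ s, u.map f = t := by
  induction s using Quotient.inductionOn with | _ l
  induction t using Quotient.inductionOn with | _ m
  obtain ⟨m', hperm, hsub⟩ := h
  obtain ⟨u, hu, rfl⟩ := List.sublist_map_iff.mp hsub
  exact ⟨u, hu.subperm, Multiset.coe_eq_coe.mpr hperm⟩

/-- `η(H) ≤ t(G)` for every subgroup `H` of a finite group `G`. -/
theorem etaC_addSubgroup_le_tC (G : Type*) [AddCommGroup G] [Fintype G] (H : AddSubgroup G) :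
    etaC H ≤ tC G := by
  obtain ⟨hpos, htiny⟩ := Nat.sInf_mem (exists_pos_forall_exists_isTinyZS G)
  refine Nat.sInf_le ⟨hpos, fun S hS => ?_⟩
  obtain ⟨T, hT, hTtiny⟩ := htiny (S.map H.subtype) (by rwa [Multiset.card_map])
  obtain ⟨U, hU, rfl⟩ := exists_le_map_eq_of_le_map hT
  obtain ⟨hne, hsum, hcross⟩ := hTtiny.of_map H.subtype H.subtype_injective
  exact ⟨U, hU, hne, hsum, card_le_exponent_of_crossNum_le_one hcross⟩

/-- If `t(G) = η(G)` then `η(H) ≤ η(G)` for every subgroup `H` of `G`. -/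
theorem stmt18 (G : Type*) [AddCommGroup G] [Fintype G]
    (h : tC G = etaC G) (H : AddSubgroup G) :
    etaC H ≤ etaC G := by
  exact h ▸ etaC_addSubgroup_le_tC G H
end

section
/- For every integer r ≥ 4, there exists a finite abelian group G of rank r such that t(G) > η(G). In fact, one may take G = C_3^{r−1} ⊕ C_{3^α} for any integer α ≥ 2 satisfying 2r − 1 ≤ 3^α ≤ 2^r − r, and such an α always exists. -/
open Multiset Finset

/-- `G` is generated by finitely many elements `e i` with `q i • e i = 0`, where every `q i` is a
power of `p` and `∑ i, (q i - 1) = N`. -/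
def HasPrimePowerGenerators (p : ℕ) (G : Type*) [AddCommGroup G] (N : ℕ) : Prop :=
  ∃ (ι : Type) (_ : Fintype ι) (e : ι → G) (q : ι → ℕ),
    (∀ i, ∃ k, q i = p ^ k) ∧ (∀ i, q i • e i = 0) ∧
      AddSubmonoid.closure (Set.range e) = ⊤ ∧ ∑ i, (q i - 1) = N

section Olson

open AddMonoidAlgebra

variable {p : ℕ} [Fact p.Prime] {G ι κ : Type*} [AddCommGroup G]

lemma one_sub_single_mem_span {e : ι → G} (he : AddSubmonoid.closure (Set.range e) = ⊤) (g : G) :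
    (1 - single g 1 : AddMonoidAlgebra (ZMod p) G) ∈
      Ideal.span (Set.range fun i => (1 - single (e i) 1 : AddMonoidAlgebra (ZMod p) G)) := by
  have hg : g ∈ AddSubmonoid.closure (Set.range e) := he ▸ AddSubmonoid.mem_top g
  induction hg using AddSubmonoid.closure_induction with
  | mem x hx =>
    obtain ⟨i, rfl⟩ := hx
    exact Ideal.subset_span ⟨i, rfl⟩
  | zero => simp [AddMonoidAlgebra.one_def]
  | add x y _ _ hx hy =>
    have h : (1 - single (x + y) 1 : AddMonoidAlgebra (ZMod p) G) =
        (1 - single x 1) + single x 1 * (1 - single y 1) := by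
      rw [mul_sub, single_mul_single, mul_one, mul_one]
      abel
    rw [h]
    exact Ideal.add_mem _ hx (Ideal.mul_mem_left _ _ hy)

lemma one_sub_single_pow_eq_zero {g : G} {k : ℕ} (hg : p ^ k • g = 0) :
    (1 - single g 1 : AddMonoidAlgebra (ZMod p) G) ^ p ^ k = 0 := by
  have : CharP (AddMonoidAlgebra (ZMod p) G) p := charP_of_injective_algebraMap' (ZMod p) p
  rw [sub_pow_char_pow, one_pow, single_pow, hg, one_pow, AddMonoidAlgebra.one_def, sub_self]

/-- If `x i ^ q i = 0` for all `i`, a product of more than `∑ i, (q i - 1)` elements of the ideal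
generated by the `x i` vanishes. -/
lemma prod_eq_zero_of_mem_span_of_pow_eq_zero {R : Type*} [CommRing R] [Fintype ι]
    {x : ι → R} {q : ι → ℕ} (hx : ∀ i, x i ^ q i = 0) {y : κ → R} {A : Finset κ}
    (hy : ∀ j ∈ A, y j ∈ Ideal.span (Set.range x)) (hA : ∑ i, (q i - 1) < A.card) :
    ∏ j ∈ A, y j = 0 := by
  classical
  have hc : ∀ j : A, ∃ c : ι → R, ∑ i, c i * x i = y j := fun j =>
    Ideal.mem_span_range_iff_exists_fun.1 (hy j j.2)
  choose c hc using hc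
  rw [← Finset.prod_coe_sort]
  simp_rw [← hc]
  rw [Finset.prod_univ_sum]
  refine Finset.sum_eq_zero fun f _ => ?_
  rw [Finset.prod_mul_distrib, ← Finset.prod_fiberwise' Finset.univ f x]
  have hcard : ∑ i, (q i - 1) < ∑ i, (Finset.univ.filter fun j => f j = i).card := by
    have h := Finset.card_eq_sum_card_fiberwise (f := f) (s := Finset.univ) (t := Finset.univ)
      fun _ _ => Finset.mem_coe.2 (Finset.mem_univ _)
    rw [Finset.card_univ, Fintype.card_coe] at h
    exact hA.trans_eq h
  obtain ⟨i, -, hi⟩ := Finset.exists_lt_of_sum_lt hcard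
  rw [Finset.prod_eq_zero (Finset.mem_univ i), mul_zero]
  rw [Finset.prod_const]
  exact pow_eq_zero_of_le (by omega) (hx i)

/-- Olson's upper bound for the Davenport constant of a finite abelian `p`-group. -/
theorem HasPrimePowerGenerators.exists_sum_eq_zero {N : ℕ} (hG : HasPrimePowerGenerators p G N)
    (g : κ → G) {A : Finset κ} (hA : N < A.card) :
    ∃ T ⊆ A, T.Nonempty ∧ ∑ j ∈ T, g j = 0 := by
  classical
  obtain ⟨ι, _, e, q, hq, hqe, he, rfl⟩ := hG
  have hzero : ∏ j ∈ A, (1 - single (g j) 1 : AddMonoidAlgebra (ZMod p) G) = 0 := by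
    refine prod_eq_zero_of_mem_span_of_pow_eq_zero
      (x := fun i => (1 - single (e i) 1 : AddMonoidAlgebra (ZMod p) G)) (q := q) (fun i => ?_)
      (fun j _ => one_sub_single_mem_span he (g j)) hA
    obtain ⟨k, hk⟩ := hq i
    rw [hk]
    exact one_sub_single_pow_eq_zero (hk ▸ hqe i)
  by_contra! hT
  have hprod : ∀ T : Finset κ, ∏ j ∈ T, (single (g j) 1 : AddMonoidAlgebra (ZMod p) G) =
      single (∑ j ∈ T, g j) 1 := by
    intro T
    induction T using Finset.induction_on with
    | empty => simp [AddMonoidAlgebra.one_def]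
    | insert j T hj ih =>
      rw [Finset.prod_insert hj, Finset.sum_insert hj, ih, single_mul_single, mul_one]
  have hcoeff := congrArg (fun f => coeffAddEquiv f 0) hzero
  simp only [Finset.prod_sub, Finset.prod_const_one, mul_one, hprod, map_sum,
    Finsupp.coe_finsetSum, Finset.sum_apply] at hcoeff
  rw [Finset.sum_eq_single ∅] at hcoeff
  · simp at hcoeff
  · intro T hTA hT0
    have h := hT T (Finset.mem_powerset.1 hTA) (Finset.nonempty_iff_ne_empty.2 hT0)
    rcases neg_one_pow_eq_or (AddMonoidAlgebra (ZMod p) G) T.card with h1 | h1 <;>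
      simp [h1, h]
  · simp

end Olson

section Generators

variable {p : ℕ} {G : Type*} [AddCommGroup G] {N : ℕ}

lemma HasPrimePowerGenerators.prod_zmod [NeZero p] (hG : HasPrimePowerGenerators p G N) (k : ℕ) :
    HasPrimePowerGenerators p (G × ZMod (p ^ k)) (N + (p ^ k - 1)) := by
  obtain ⟨ι, _, e, q, hq, hqe, he, rfl⟩ := hG
  refine ⟨Option ι, inferInstance, fun o => o.elim (0, 1) fun i => (e i, 0),
    fun o => o.elim (p ^ k) q, ?_, ?_, ?_, ?_⟩
  · rintro (_ | i)
    exacts [⟨k, rfl⟩, hq i]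
  · rintro (_ | i)
    · simp [Prod.ext_iff, -Nat.cast_pow]
    · simp [Prod.ext_iff, hqe i]
  · rw [eq_top_iff]
    rintro ⟨g, z⟩ -
    set H := AddSubmonoid.closure (Set.range fun o : Option ι =>
      (o.elim (0, 1) fun i => (e i, 0) : G × ZMod (p ^ k)))
    have hg : ∀ g : G, (g, (0 : ZMod (p ^ k))) ∈ H := by
      intro g
      have hg : g ∈ AddSubmonoid.closure (Set.range e) := he ▸ AddSubmonoid.mem_top g
      induction hg using AddSubmonoid.closure_induction with
      | mem x hx =>
        obtain ⟨i, rfl⟩ := hx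
        exact AddSubmonoid.subset_closure ⟨some i, rfl⟩
      | zero => exact H.zero_mem
      | add x y _ _ hx hy => simpa using H.add_mem hx hy
    have hz : ((0 : G), z) = z.val • ((0 : G), (1 : ZMod (p ^ k))) := by
      simp
    have h := H.add_mem (hg g)
      (hz ▸ H.nsmul_mem (AddSubmonoid.subset_closure ⟨none, rfl⟩) z.val)
    simpa using h
  · rw [Fintype.sum_option, add_comm]
    rfl

lemma hasPrimePowerGenerators_pi_zmod [NeZero p] (s : ℕ) :
    HasPrimePowerGenerators p (Fin s → ZMod p) (s * (p - 1)) := by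
  refine ⟨Fin s, inferInstance, fun i => Pi.single i 1, fun _ => p, fun _ => ⟨1, (pow_one p).symm⟩,
    fun i => ?_, ?_, by simp⟩
  · rw [← Pi.single_smul]
    simp
  · rw [eq_top_iff]
    rintro v -
    have hv : v = ∑ i, (v i).val • (Pi.single i 1 : Fin s → ZMod p) := by
      ext j
      rw [Finset.sum_apply, Finset.sum_eq_single j]
      · rw [Pi.smul_apply, Pi.single_eq_same, nsmul_one, ZMod.natCast_zmod_val]
      · intro i _ hi
        rw [Pi.smul_apply, Pi.single_eq_of_ne hi.symm, nsmul_zero]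
      · exact fun h => absurd (Finset.mem_univ j) h
    rw [hv]
    exact AddSubmonoid.sum_mem _ fun i _ =>
      AddSubmonoid.nsmul_mem _ (AddSubmonoid.subset_closure (Set.mem_range_self i)) _

end Generators

/-- If the Davenport constant of the `p`-group `G` is less than `2 p ^ k`, then
`D(G) + p ^ k - 1` elements contain a zero-sum subsequence of length at most `p ^ k`. -/
lemma HasPrimePowerGenerators.exists_short_zero_sum {p : ℕ} [hp : Fact p.Prime] {G : Type*}
    [AddCommGroup G] {N k : ℕ} (hG : HasPrimePowerGenerators p G N) (hN : N + 2 ≤ 2 * p ^ k)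
    {S : Multiset G} (hS : N + p ^ k ≤ Multiset.card S) :
    ∃ S' ≤ S, S' ≠ 0 ∧ S'.sum = 0 ∧ Multiset.card S' ≤ p ^ k := by
  classical
  have hpos : 0 < p ^ k := pow_pos hp.out.pos k
  suffices h : ∃ T : Finset S, T.Nonempty ∧ ∑ j ∈ T, (j : G) = 0 ∧ T.card ≤ p ^ k by
    obtain ⟨T, hT, hsum, hcard⟩ := h
    refine ⟨T.val.map (fun j : S => (j : G)), ?_, ?_, hsum, by simpa using hcard⟩
    · conv_rhs => rw [← Multiset.map_univ_coe S]
      exact Multiset.map_le_map (Finset.val_le_iff.2 (Finset.subset_univ T))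
    · simpa using hT.ne_empty
  obtain ⟨A, -, hA⟩ := Finset.exists_subset_card_eq
    (s := (Finset.univ : Finset S)) (n := N + p ^ k) (by simpa using hS)
  obtain ⟨T, hTA, hT, hsum⟩ := (hG.prod_zmod k).exists_sum_eq_zero
    (fun j : S => ((j : G), (1 : ZMod (p ^ k)))) (A := A) (by omega)
  have hsum1 : ∑ j ∈ T, (j : G) = 0 := by
    simpa [Prod.fst_sum] using congrArg Prod.fst hsum
  have hdvd : p ^ k ∣ T.card := by
    have h := congrArg Prod.snd hsum
    rw [Prod.snd_sum] at h
    simpa only [Finset.sum_const, nsmul_one, Prod.snd_zero, ZMod.natCast_eq_zero_iff] using h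
  obtain ⟨m, hm⟩ := hdvd
  have hTcard := Finset.card_le_card hTA
  have hTpos := hT.card_pos
  have hm3 : m < 3 := by
    by_contra! h
    have := Nat.mul_le_mul_left (p ^ k) h
    omega
  interval_cases m
  · omega
  · exact ⟨T, hT, hsum1, by omega⟩
  · obtain ⟨j, hj⟩ := hT
    obtain ⟨U, hUT, hU, hUsum⟩ := hG.exists_sum_eq_zero (fun j : S => (j : G)) (A := T.erase j)
      (by rw [Finset.card_erase_of_mem hj]; omega)
    have hUT' : U ⊆ T := hUT.trans (Finset.erase_subset j T)
    by_cases hUcard : U.card ≤ p ^ k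
    · exact ⟨U, hU, hUsum, hUcard⟩
    · refine ⟨T \ U, ⟨j, Finset.mem_sdiff.2 ⟨hj, fun h => Finset.notMem_erase j T (hUT h)⟩⟩, ?_, ?_⟩
      · have h := Finset.sum_sdiff (f := fun j : S => (j : G)) hUT'
        rwa [hUsum, hsum1, add_zero] at h
      · rw [Finset.card_sdiff_of_subset hUT']
        omega

lemma crossNum_replicate {G : Type*} [AddCommGroup G] (n : ℕ) (g : G) :
    crossNum (Multiset.replicate n g) = n / addOrderOf g := by
  simp [crossNum, div_eq_mul_inv]

/-- The set of which `tC G` is the infimum is nonempty when `G` is finite. -/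
lemma exists_forall_exists_isTinyZS (G : Type*) [AddCommGroup G] [Finite G] :
    ∃ t : ℕ, 0 < t ∧ ∀ S : Multiset G, t ≤ Multiset.card S → ∃ S' ≤ S, IsTinyZS S' := by
  classical
  have := Fintype.ofFinite G
  refine ⟨∑ g : G, addOrderOf g + 1, by omega, fun S hS => ?_⟩
  have hcount : ∑ g : G, addOrderOf g < ∑ g : G, Multiset.count g S := by
    rw [Multiset.sum_count_eq_card fun _ _ => Finset.mem_univ _]
    omega
  obtain ⟨g, -, hg⟩ := Finset.exists_lt_of_sum_lt hcount
  have hpos : 0 < addOrderOf g := addOrderOf_pos g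
  refine ⟨Multiset.replicate (addOrderOf g) g, Multiset.le_count_iff_replicate_le.1 hg.le, ?_, ?_, ?_⟩
  · rw [← Multiset.card_pos, Multiset.card_replicate]
    exact hpos
  · rw [Multiset.sum_replicate, addOrderOf_nsmul_eq_zero]
  · rw [crossNum_replicate, div_self (by positivity)]

lemma card_lt_tC {G : Type*} [AddCommGroup G] [Finite G] {S : Multiset G}
    (hS : ¬ ∃ S' ≤ S, IsTinyZS S') : Multiset.card S < tC G := by
  by_contra! h
  exact hS ((Nat.sInf_mem (exists_forall_exists_isTinyZS G)).2 S h)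

lemma etaC_le {p : ℕ} [Fact p.Prime] {G : Type*} [AddCommGroup G] {N k : ℕ}
    (hG : HasPrimePowerGenerators p G N) (hN : N + 2 ≤ 2 * p ^ k)
    (hexp : p ^ k ≤ AddMonoid.exponent G) : etaC G ≤ N + p ^ k := by
  refine Nat.sInf_le ⟨?_, fun S hS => ?_⟩
  · have := pow_pos (Fact.out : p.Prime).pos k
    omega
  · obtain ⟨S', hle, h0, hsum, hcard⟩ := hG.exists_short_zero_sum hN hS
    exact ⟨S', hle, h0, hsum, hcard.trans hexp⟩

lemma le_exponent_prod_zmod (G : Type*) [AddCommGroup G] [Finite G] (n : ℕ) [NeZero n] :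
    n ≤ AddMonoid.exponent (G × ZMod n) := by
  refine Nat.le_of_dvd (AddMonoid.exponent_pos.2 AddMonoid.ExponentExists.of_finite) ?_
  have h := AddMonoid.exponent_nsmul_eq_zero ((0, 1) : G × ZMod n)
  rw [Prod.ext_iff] at h
  simpa [ZMod.natCast_eq_zero_iff] using h.2

lemma add_self_ne_zero_of_three_nsmul {H : Type*} [AddCommGroup H] {c : H} (hc : c ≠ 0)
    (hc3 : 3 • c = 0) : c + c ≠ 0 := fun h => hc (by
  have h3 : 3 • c = (c + c) + c := by abel
  rwa [h, hc3, zero_add, eq_comm] at h3)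

/-- The elements of `C_3^s ⊕ H` whose coordinates in `C_3` lie in `{0, 1}` and whose last coordinate
lies in `{0, c}`, except `0`. -/
def cubeErase {H : Type*} [AddCommGroup H] [DecidableEq H] (s : ℕ) (c : H) :
    Finset ((Fin s → ZMod 3) × H) :=
  (Fintype.piFinset (fun _ => {0, 1}) ×ˢ {0, c}).erase 0

section Cube

variable {H : Type*} [AddCommGroup H] [DecidableEq H] {s : ℕ} {c : H}

lemma mem_cubeErase {x : (Fin s → ZMod 3) × H} :
    x ∈ cubeErase s c ↔ x ≠ 0 ∧ (∀ i, x.1 i = 0 ∨ x.1 i = 1) ∧ (x.2 = 0 ∨ x.2 = c) := by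
  simp [cubeErase, Fintype.mem_piFinset]

lemma card_cubeErase (hc : c ≠ 0) : (cubeErase s c).card = 2 ^ (s + 1) - 1 := by
  rw [cubeErase, Finset.card_erase_of_mem, Finset.card_product, Fintype.card_piFinset]
  · rw [Finset.card_pair hc.symm, Finset.prod_const, Finset.card_pair zero_ne_one,
      Finset.card_univ, Fintype.card_fin, pow_succ]
  · simp [Fintype.mem_piFinset]

lemma addOrderOf_of_mem_cubeErase (hc3 : 3 • c = 0) {x : (Fin s → ZMod 3) × H}
    (hx : x ∈ cubeErase s c) : addOrderOf x = 3 := by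
  rw [mem_cubeErase] at hx
  refine addOrderOf_eq_prime (Prod.ext (funext fun i => ?_) ?_) hx.1
  · have h3 : ∀ z : ZMod 3, 3 • z = 0 := by decide
    exact h3 _
  · rcases hx.2.2 with h | h <;> simp [h, hc3]

lemma add_ne_zero_of_mem_cubeErase (hc : c ≠ 0) (hc3 : 3 • c = 0) {x y : (Fin s → ZMod 3) × H}
    (hx : x ∈ cubeErase s c) (hy : y ∈ cubeErase s c) : x + y ≠ 0 := by
  rw [mem_cubeErase] at hx hy
  intro h
  rw [Prod.ext_iff] at h
  refine hx.1 (Prod.ext (funext fun i => ?_) ?_)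
  · have h3 : ∀ a b : ZMod 3, (a = 0 ∨ a = 1) → (b = 0 ∨ b = 1) → a + b = 0 → a = 0 := by decide
    exact h3 _ _ (hx.2.1 i) (hy.2.1 i) (congrFun h.1 i)
  · have hcc := add_self_ne_zero_of_three_nsmul hc hc3
    have h2 : x.2 + y.2 = 0 := h.2
    rcases hx.2.2 with h5 | h5 <;> rcases hy.2.2 with h6 | h6 <;> simp_all

lemma eq_of_add_add_eq_zero_of_mem_cubeErase (hc : c ≠ 0) (hc3 : 3 • c = 0)
    {x y z : (Fin s → ZMod 3) × H} (hx : x ∈ cubeErase s c) (hy : y ∈ cubeErase s c)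
    (hz : z ∈ cubeErase s c) (h : x + (y + z) = 0) : x = y ∧ y = z := by
  rw [mem_cubeErase] at hx hy hz
  rw [Prod.ext_iff] at h
  have h3 : ∀ a b d : ZMod 3, (a = 0 ∨ a = 1) → (b = 0 ∨ b = 1) → (d = 0 ∨ d = 1) →
      a + (b + d) = 0 → a = b ∧ b = d := by decide
  have h1 := fun i => h3 _ _ _ (hx.2.1 i) (hy.2.1 i) (hz.2.1 i) (congrFun h.1 i)
  have hcc := add_self_ne_zero_of_three_nsmul hc hc3
  have h2 : x.2 + (y.2 + z.2) = 0 := h.2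
  have h2' : x.2 = y.2 ∧ y.2 = z.2 := by
    rcases hx.2.2 with h5 | h5 <;> rcases hy.2.2 with h6 | h6 <;> rcases hz.2.2 with h7 | h7 <;>
      simp_all
  exact ⟨Prod.ext (funext fun i => (h1 i).1) h2'.1, Prod.ext (funext fun i => (h1 i).2) h2'.2⟩

lemma not_exists_isTinyZS_cubeErase (hc : c ≠ 0) (hc3 : 3 • c = 0) :
    ¬ ∃ S' ≤ 2 • (cubeErase s c).val, IsTinyZS S' := by
  rintro ⟨S, hle, h0, hsum, hcross⟩
  have hmem : ∀ x ∈ S, x ∈ cubeErase s c := fun x hx =>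
    Multiset.mem_of_mem_nsmul (Multiset.mem_of_le hle hx)
  have hk : crossNum S = Multiset.card S / 3 := by
    rw [crossNum, Multiset.map_congr rfl fun x hx => by
      rw [addOrderOf_of_mem_cubeErase hc3 (hmem x hx)]]
    simp [div_eq_mul_inv]
  have hcard : Multiset.card S ≤ 3 := by
    rw [hk, div_le_one (by norm_num)] at hcross
    exact_mod_cast hcross
  have hpos := Multiset.card_pos.2 h0
  interval_cases h : Multiset.card S
  · obtain ⟨x, rfl⟩ := Multiset.card_eq_one.1 h
    simp only [Multiset.mem_singleton, forall_eq, Multiset.sum_singleton] at hmem hsum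
    exact (mem_cubeErase.1 hmem).1 hsum
  · obtain ⟨x, y, rfl⟩ := Multiset.card_eq_two.1 h
    exact add_ne_zero_of_mem_cubeErase hc hc3 (hmem x (by simp)) (hmem y (by simp))
      (by simpa using hsum)
  · obtain ⟨x, y, z, rfl⟩ := Multiset.card_eq_three.1 h
    obtain ⟨rfl, rfl⟩ := eq_of_add_add_eq_zero_of_mem_cubeErase hc hc3 (hmem x (by simp))
      (hmem y (by simp)) (hmem z (by simp)) (by simpa using hsum)
    have hcount := Multiset.count_le_of_le x hle
    have hnodup := Multiset.nodup_iff_count_le_one.1 (cubeErase s c).nodup x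
    rw [Multiset.count_nsmul] at hcount
    simp at hcount
    omega

end Cube

lemma hasRank_pi_zmod_prod_zmod {m n : ℕ} (hm : 1 < m) (hn : 1 < n) (hmn : m ∣ n) (s : ℕ) :
    HasRank ((Fin s → ZMod m) × ZMod n) (s + 1) := by
  let f : Fin (s + 1) → ℕ := Fin.snoc (α := fun _ => ℕ) (fun _ => m) n
  have hcast : ∀ i : Fin s, f i.castSucc = m := fun i => Fin.snoc_castSucc ..
  have hlast : f (Fin.last s) = n := Fin.snoc_last ..
  refine ⟨f, fun i => ?_, fun i j hij => ?_, ⟨?_⟩⟩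
  · induction i using Fin.lastCases with
    | last => rwa [hlast]
    | cast i => rwa [hcast]
  · induction j using Fin.lastCases with
    | last =>
      induction i using Fin.lastCases with
      | last => exact dvd_rfl
      | cast i => rwa [hcast, hlast]
    | cast j =>
      induction i using Fin.lastCases with
      | last => exact absurd hij (by simp [Fin.le_def])
      | cast i => rw [hcast, hcast]
  · let e : (ZMod (f (Fin.last s)) × ((i : Fin s) → ZMod (f i.castSucc))) ≃+
        ((i : Fin (s + 1)) → ZMod (f i)) :=
      AddEquiv.symm
        { (Fin.snocEquiv fun i => ZMod (f i)).symm with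
          map_add' := fun _ _ => rfl }
    exact (AddEquiv.prodComm.trans (AddEquiv.prodCongr
      (ZMod.ringEquivCongr hlast.symm).toAddEquiv
      (AddEquiv.piCongrRight fun i => (ZMod.ringEquivCongr (hcast i).symm).toAddEquiv))).trans e

lemma seven_mul_le_two_pow {r : ℕ} (hr : 6 ≤ r) : 7 * r ≤ 2 ^ r := by
  induction r, hr using Nat.le_induction with
  | base => norm_num
  | succ r hr ih =>
    rw [pow_succ]
    omega

lemma exists_three_pow_mem_Icc {r : ℕ} (hr : 4 ≤ r) :
    ∃ α : ℕ, 2 ≤ α ∧ 2 * r - 1 ≤ 3 ^ α ∧ 3 ^ α ≤ 2 ^ r - r := by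
  by_cases hr6 : r < 6
  · refine ⟨2, le_rfl, ?_⟩
    interval_cases r <;> norm_num
  · have hr6 : 6 ≤ r := by omega
    have hlt := Nat.pow_pred_clog_lt_self (b := 3) (x := 2 * r - 1) (by norm_num) (by omega)
    have hle := Nat.le_pow_clog (b := 3) (by norm_num) (2 * r - 1)
    have h7 := seven_mul_le_two_pow hr6
    have hα : 2 ≤ Nat.clog 3 (2 * r - 1) := by
      by_contra! h
      have := Nat.pow_le_pow_right (n := 3) (by norm_num) (Nat.le_of_lt_succ h)
      omega
    refine ⟨Nat.clog 3 (2 * r - 1), hα, hle, ?_⟩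
    obtain ⟨β, hβ⟩ := Nat.exists_eq_succ_of_ne_zero (n := Nat.clog 3 (2 * r - 1)) (by omega)
    rw [hβ] at hlt ⊢
    rw [pow_succ]
    simp only [Nat.pred_succ] at hlt
    omega

/-- For every `r ≥ 4` there is an integer `α ≥ 2` with `2r - 1 ≤ 3^α ≤ 2^r - r`, and for
every such `α`, the finite abelian group `G = C_3^{r-1} ⊕ C_{3^α}` (which has rank `r`)
satisfies `t(G) > η(G)`. -/
theorem stmt19 (r : ℕ) (hr : 4 ≤ r) :
    (∃ α : ℕ, 2 ≤ α ∧ 2 * r - 1 ≤ 3 ^ α ∧ 3 ^ α ≤ 2 ^ r - r) ∧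
    ∀ α : ℕ, 2 ≤ α → 2 * r - 1 ≤ 3 ^ α → 3 ^ α ≤ 2 ^ r - r →
      HasRank ((Fin (r - 1) → ZMod 3) × ZMod (3 ^ α)) r ∧
      etaC ((Fin (r - 1) → ZMod 3) × ZMod (3 ^ α)) <
        tC ((Fin (r - 1) → ZMod 3) × ZMod (3 ^ α)) := by
  refine ⟨exists_three_pow_mem_Icc hr, fun α hα hlow hupp => ?_⟩
  obtain ⟨s, rfl⟩ := Nat.exists_eq_add_of_le' (show 1 ≤ r by omega)
  rw [Nat.add_sub_cancel]
  obtain ⟨β, rfl⟩ := Nat.exists_eq_add_of_le' (show 1 ≤ α by omega)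
  refine ⟨hasRank_pi_zmod_prod_zmod (by norm_num) (Nat.one_lt_pow (by omega) (by norm_num))
    (dvd_pow_self 3 (by omega)) s, ?_⟩
  have hc : ((3 ^ β : ℕ) : ZMod (3 ^ (β + 1))) ≠ 0 := by
    rw [Ne, ZMod.natCast_eq_zero_iff, Nat.pow_dvd_pow_iff_le_right (by norm_num)]
    omega
  have hc3 : 3 • ((3 ^ β : ℕ) : ZMod (3 ^ (β + 1))) = 0 := by
    rw [nsmul_eq_mul, ← Nat.cast_mul, ZMod.natCast_eq_zero_iff, pow_succ']
  have ht := card_lt_tC (not_exists_isTinyZS_cubeErase (s := s) hc hc3)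
  rw [Multiset.card_nsmul, Finset.card_val, card_cubeErase hc] at ht
  have hη := etaC_le (k := β + 1)
    ((hasPrimePowerGenerators_pi_zmod (p := 3) s).prod_zmod (β + 1)) (by omega)
    (le_exponent_prod_zmod _ _)
  omega
end
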